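/- arXiv:2501.04887 — 2 statements merged into one kernel-verified Lean document; each statement's English description precedes it below -/
import Mathlib

section
/- For every prime p and every 1-bounded function f2 : F_p^2 → ℂ, defining F2(m2,h) = Σ_{m1∈F_p} Δ_{h} f̂2(m1,m2) for h ∈ F_p^2, one has ‖conj(F2)(m2,h)·F2(m2′,h)‖_{ℓ^2_{m2,m2′,h}} ≤ ‖f2‖_{U^2(0×F_p)}^2. -/
open scoped BigOperators ComplexOrder
open Polynomial

noncomputable section

namespace RatCorners

/-- Reduction of a rational number modulo `p` (genuine when `p` does not divide the
denominator). -/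
def ratRed (p : ℕ) (q : ℚ) : ZMod p := (q.num : ZMod p) * (q.den : ZMod p)⁻¹

/-- Coefficientwise reduction of a polynomial with rational coefficients modulo `p`. -/
def polyRed (p : ℕ) (f : Polynomial ℚ) : Polynomial (ZMod p) :=
  f.sum fun n a => Polynomial.C (ratRed p a) * Polynomial.X ^ n

/-- `p` divides no denominator of any coefficient of `P` (with numerator and denominator
of `P` in lowest terms). -/
def Admissible (p : ℕ) (P : RatFunc ℚ) : Prop :=
  (∀ n, ¬ p ∣ (P.num.coeff n).den) ∧ ∀ n, ¬ p ∣ (P.denom.coeff n).den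

/-- `y` is a pole of the reduction of `P` modulo `p`. -/
def IsPole (p : ℕ) (P : RatFunc ℚ) (y : ZMod p) : Prop :=
  (polyRed p P.denom).eval y = 0

instance (p : ℕ) (P : RatFunc ℚ) : DecidablePred (IsPole p P) := fun y =>
  inferInstanceAs (Decidable ((polyRed p P.denom).eval y = 0))

/-- Evaluation of the reduction of `P` modulo `p` at `y` (junk value `0` at poles). -/
def evalRed (p : ℕ) (P : RatFunc ℚ) (y : ZMod p) : ZMod p :=
  (polyRed p P.num).eval y * ((polyRed p P.denom).eval y)⁻¹

/-- A function is `1`-bounded if all its values have norm at most `1`. -/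
def OneBounded {α : Type*} (f : α → ℂ) : Prop := ∀ x, ‖f x‖ ≤ 1

/-- The formal derivative of a rational function. -/
def ratDeriv (P : RatFunc ℚ) : RatFunc ℚ :=
  algebraMap (Polynomial ℚ) (RatFunc ℚ)
      (Polynomial.derivative P.num * P.denom - P.num * Polynomial.derivative P.denom) /
    algebraMap (Polynomial ℚ) (RatFunc ℚ) (P.denom ^ 2)

/-- Substitution of the variable `y i` into a rational function `P ∈ ℚ(t)`, producing an
element of the rational function field `ℚ(y 0, …, y (n-1))`. -/
def substAt {n : ℕ} (P : RatFunc ℚ) (i : Fin n) : FractionRing (MvPolynomial (Fin n) ℚ) :=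
  Polynomial.eval₂
      ((algebraMap (MvPolynomial (Fin n) ℚ) (FractionRing (MvPolynomial (Fin n) ℚ))).comp
        MvPolynomial.C)
      (algebraMap (MvPolynomial (Fin n) ℚ) (FractionRing (MvPolynomial (Fin n) ℚ))
        (MvPolynomial.X i)) P.num /
    Polynomial.eval₂
      ((algebraMap (MvPolynomial (Fin n) ℚ) (FractionRing (MvPolynomial (Fin n) ℚ))).comp
        MvPolynomial.C)
      (algebraMap (MvPolynomial (Fin n) ℚ) (FractionRing (MvPolynomial (Fin n) ℚ))
        (MvPolynomial.X i)) P.denom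

variable (p : ℕ) [NeZero p]

/-- The counting operator `𝔼_{x₁,x₂,y} f₀(x₁,x₂) f₁(x₁+P(y),x₂) f₂(x₁,x₂+Q(y))`,
where the average in `y` avoids the poles of `P` and `Q` but is still normalized by `1/p`. -/
def cornerAvg (P Q : RatFunc ℚ) (f0 f1 f2 : ZMod p × ZMod p → ℂ) : ℂ :=
  (p : ℂ)⁻¹ ^ 3 * ∑ x1 : ZMod p, ∑ x2 : ZMod p, ∑ y : ZMod p,
    if ¬ IsPole p P y ∧ ¬ IsPole p Q y then
      f0 (x1, x2) * f1 (x1 + evalRed p P y, x2) * f2 (x1, x2 + evalRed p Q y)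
    else 0

/-- The main term `𝔼_{x₁,x₂} f₀(x₁,x₂) · 𝔼_a f₁(a,x₂) · 𝔼_b f₂(x₁,b)`. -/
def mainTerm (f0 f1 f2 : ZMod p × ZMod p → ℂ) : ℂ :=
  (p : ℂ)⁻¹ ^ 2 * ∑ x1 : ZMod p, ∑ x2 : ZMod p,
    f0 (x1, x2) * ((p : ℂ)⁻¹ * ∑ a : ZMod p, f1 (a, x2)) *
      ((p : ℂ)⁻¹ * ∑ b : ZMod p, f2 (x1, b))

/-- The `L^r` norm with respect to the uniform probability measure on `(ZMod p)²`. -/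
def Lnorm (r : ℝ) (f : ZMod p × ZMod p → ℂ) : ℝ :=
  ((p : ℝ)⁻¹ ^ 2 * ∑ x : ZMod p × ZMod p, ‖f x‖ ^ r) ^ r⁻¹

/-- The Gowers norm `‖f‖_{U²(0×F_p)}` along the second coordinate axis. -/
def U2vert (f : ZMod p × ZMod p → ℂ) : ℝ :=
  ((p : ℝ)⁻¹ ^ 4 * (∑ x : ZMod p × ZMod p, ∑ h : ZMod p, ∑ k : ZMod p,
      f x * (starRingEnd ℂ) (f (x + (0, h))) * (starRingEnd ℂ) (f (x + (0, k))) *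
        f (x + (0, h + k))).re) ^ ((4:ℝ)⁻¹)

/-- The Gowers norm `‖f‖_{U²(F_p×0)}` along the first coordinate axis. -/
def U2horiz (f : ZMod p × ZMod p → ℂ) : ℝ :=
  ((p : ℝ)⁻¹ ^ 4 * (∑ x : ZMod p × ZMod p, ∑ h : ZMod p, ∑ k : ZMod p,
      f x * (starRingEnd ℂ) (f (x + (h, 0))) * (starRingEnd ℂ) (f (x + (k, 0))) *
        f (x + (h + k, 0))).re) ^ ((4:ℝ)⁻¹)

/-- The additive character `e_p(x) = e^{2πix/p}` on `ZMod p`. -/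
def ep (x : ZMod p) : ℂ := Complex.exp (2 * Real.pi * Complex.I * (x.val : ℂ) / (p : ℂ))

/-- `e(r) = e^{2πir}` for a real number `r`. -/
def eC (r : ℝ) : ℂ := Complex.exp (2 * Real.pi * Complex.I * (r : ℂ))

/-- The Fourier transform `f̂(ξ) = 𝔼_x f(x) e_p(−x·ξ)` on `(ZMod p)²`. -/
def dft (f : ZMod p × ZMod p → ℂ) (ξ : ZMod p × ZMod p) : ℂ :=
  (p : ℂ)⁻¹ ^ 2 * ∑ x : ZMod p × ZMod p, f x * ep p (-(x.1 * ξ.1 + x.2 * ξ.2))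

/-- `F₁(n₁,𝐡) = ∑_{n₂} Δ_{−𝐡} f̂₁(n₁,n₂)` where `Δ_h g(x) = g(x)·conj g(x+h)`. -/
def F1 (f : ZMod p × ZMod p → ℂ) (n1 : ZMod p) (h : ZMod p × ZMod p) : ℂ :=
  ∑ n2 : ZMod p, dft p f (n1, n2) * (starRingEnd ℂ) (dft p f ((n1, n2) + -h))

/-- `F₂(m₂,𝐡) = ∑_{m₁} Δ_{𝐡} f̂₂(m₁,m₂)` where `Δ_h g(x) = g(x)·conj g(x+h)`. -/
def F2 (f : ZMod p × ZMod p → ℂ) (m2 : ZMod p) (h : ZMod p × ZMod p) : ℂ :=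
  ∑ m1 : ZMod p, dft p f (m1, m2) * (starRingEnd ℂ) (dft p f ((m1, m2) + h))

/-- The `F_p`-points of the Roth variety for corners associated to `P, Q`:
tuples `(y₁,…,y₁₆)` (indexed here by `0,…,15`) avoiding all poles of `P` and `Q` and
satisfying the ten defining equations. -/
def IsRothPoint (P Q : RatFunc ℚ) (y : Fin 16 → ZMod p) : Prop :=
  (∀ i, ¬ IsPole p P (y i)) ∧ (∀ i, ¬ IsPole p Q (y i)) ∧
  evalRed p P (y 0) - evalRed p P (y 2) - evalRed p P (y 8) + evalRed p P (y 10) = 0 ∧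
  evalRed p P (y 1) - evalRed p P (y 3) - evalRed p P (y 9) + evalRed p P (y 11) = 0 ∧
  evalRed p P (y 4) - evalRed p P (y 6) - evalRed p P (y 12) + evalRed p P (y 14) = 0 ∧
  evalRed p P (y 5) - evalRed p P (y 7) - evalRed p P (y 13) + evalRed p P (y 15) = 0 ∧
  evalRed p Q (y 0) - evalRed p Q (y 1) - evalRed p Q (y 8) + evalRed p Q (y 9) = 0 ∧
  evalRed p Q (y 2) - evalRed p Q (y 6) - evalRed p Q (y 10) + evalRed p Q (y 14) = 0 ∧
  evalRed p Q (y 3) - evalRed p Q (y 7) - evalRed p Q (y 11) + evalRed p Q (y 15) = 0 ∧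
  evalRed p Q (y 4) - evalRed p Q (y 5) - evalRed p Q (y 12) + evalRed p Q (y 13) = 0 ∧
  evalRed p P (y 8) - evalRed p P (y 9) - evalRed p P (y 10) + evalRed p P (y 11) -
      evalRed p P (y 12) + evalRed p P (y 13) + evalRed p P (y 14) - evalRed p P (y 15) = 0 ∧
  evalRed p Q (y 8) - evalRed p Q (y 9) - evalRed p Q (y 10) + evalRed p Q (y 11) -
      evalRed p Q (y 12) + evalRed p Q (y 13) + evalRed p Q (y 14) - evalRed p Q (y 15) = 0

/-- `|Y(F_p)|`, the number of `F_p`-points of the Roth variety for corners. -/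
def rothCard (P Q : RatFunc ℚ) : ℕ :=
  Nat.card {y : Fin 16 → ZMod p // IsRothPoint p P Q y}

/-- `χ` is an eigenfunction with respect to the first coordinate:
`χ(x₁,x₂) = 1_E(x₂) e_p(φ(x₂)x₁) e(ψ(x₂))`. -/
def IsEigen1 (χ : ZMod p × ZMod p → ℂ) : Prop :=
  ∃ (E : Finset (ZMod p)) (φ : ZMod p → ZMod p) (ψ : ZMod p → ℝ),
    ∀ x1 x2 : ZMod p,
      χ (x1, x2) = (if x2 ∈ E then 1 else 0) * ep p (φ x2 * x1) * eC (ψ x2)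

/-- `χ` is an eigenfunction with respect to the second coordinate:
`χ(x₁,x₂) = 1_E(x₁) e_p(φ(x₁)x₂) e(ψ(x₁))`. -/
def IsEigen2 (χ : ZMod p × ZMod p → ℂ) : Prop :=
  ∃ (E : Finset (ZMod p)) (φ : ZMod p → ZMod p) (ψ : ZMod p → ℝ),
    ∀ x1 x2 : ZMod p,
      χ (x1, x2) = (if x1 ∈ E then 1 else 0) * ep p (φ x1 * x2) * eC (ψ x1)

/-- The two-term counting operator `𝔼_{x₁,x₂,y} f₀(x₁,x₂) f₁(x₁+P(y),x₂)`. -/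
def twoAvg1 (P : RatFunc ℚ) (f0 f1 : ZMod p × ZMod p → ℂ) : ℂ :=
  (p : ℂ)⁻¹ ^ 3 * ∑ x1 : ZMod p, ∑ x2 : ZMod p, ∑ y : ZMod p,
    if ¬ IsPole p P y then f0 (x1, x2) * f1 (x1 + evalRed p P y, x2) else 0

/-- The two-term counting operator `𝔼_{x₁,x₂,y} f₀(x₁,x₂) f₁(x₁,x₂+P(y))`. -/
def twoAvg2 (P : RatFunc ℚ) (f0 f1 : ZMod p × ZMod p → ℂ) : ℂ :=
  (p : ℂ)⁻¹ ^ 3 * ∑ x1 : ZMod p, ∑ x2 : ZMod p, ∑ y : ZMod p,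
    if ¬ IsPole p P y then f0 (x1, x2) * f1 (x1, x2 + evalRed p P y) else 0

/-- **Parseval's identity** on `ZMod p`, in polarized form. -/
lemma sum_dft_mul_conj_dft (g h : ZMod p → ℂ) :
    ∑ k, ZMod.dft g k * (starRingEnd ℂ) (ZMod.dft h k) =
      p * ∑ x, g x * (starRingEnd ℂ) (h x) := by
  simp only [ZMod.dft_apply, smul_eq_mul, map_sum, map_mul, ← AddChar.map_neg_eq_conj, neg_neg,
    Finset.sum_mul_sum]
  rw [Finset.sum_comm, Finset.mul_sum]
  refine Finset.sum_congr rfl fun x _ => ?_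
  rw [Finset.sum_comm]
  have horth (y : ZMod p) :
      ∑ k, ZMod.stdAddChar (-(x * k)) * g x * (ZMod.stdAddChar (y * k) * (starRingEnd ℂ) (h y)) =
        if x = y then p * (g x * (starRingEnd ℂ) (h y)) else 0 := by
    calc
      _ = (∑ k : ZMod p, ZMod.stdAddChar (k * (y - x))) * (g x * (starRingEnd ℂ) (h y)) := by
        rw [Finset.sum_mul]
        refine Finset.sum_congr rfl fun k _ => ?_
        rw [show k * (y - x) = -(x * k) + y * k by ring, AddChar.map_add_eq_mul]
        ring
      _ = _ := by
        rw [AddChar.sum_mulShift _ (ZMod.isPrimitive_stdAddChar p), ZMod.card]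
        by_cases hxy : x = y
        · simp [hxy]
        · simp [hxy, sub_eq_zero, Ne.symm hxy]
  simp [horth]

/-- **Parseval's identity** on `ZMod p`. -/
lemma sum_norm_dft_sq (g : ZMod p → ℂ) :
    ∑ k, ‖ZMod.dft g k‖ ^ 2 = p * ∑ x, ‖g x‖ ^ 2 := by
  have h := sum_dft_mul_conj_dft p g g
  simp only [Complex.mul_conj'] at h
  exact_mod_cast h

lemma ep_eq_stdAddChar (x : ZMod p) : ep p x = ZMod.stdAddChar x := by
  rw [ZMod.stdAddChar_apply, ZMod.toCircle_apply, ep]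

/-- The normalized Fourier transform in the second coordinate. -/
def vertDft (f : ZMod p × ZMod p → ℂ) (m x : ZMod p) : ℂ :=
  (p : ℂ)⁻¹ * ZMod.dft (fun y => f (x, y)) m

lemma dft_eq_dft_vertDft (f : ZMod p × ZMod p → ℂ) (m1 m2 : ZMod p) :
    dft p f (m1, m2) = (p : ℂ)⁻¹ * ZMod.dft (vertDft p f m2) m1 := by
  simp only [dft, ZMod.dft_apply, vertDft, ep_eq_stdAddChar, smul_eq_mul, Finset.mul_sum,
    Fintype.sum_prod_type, neg_add, AddChar.map_add_eq_mul]
  refine Finset.sum_congr rfl fun x _ => Finset.sum_congr rfl fun y _ => ?_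
  ring

/-- The Fourier transform intertwines translation and modulation. -/
lemma dft_add (g : ZMod p → ℂ) (k l : ZMod p) :
    ZMod.dft g (k + l) = ZMod.dft (fun x => ZMod.stdAddChar (-(x * l)) * g x) k := by
  simp only [ZMod.dft_apply, smul_eq_mul, mul_add, neg_add, AddChar.map_add_eq_mul, mul_assoc]

lemma F2_eq (f : ZMod p × ZMod p → ℂ) (m h1 h2 : ZMod p) :
    F2 p f m (h1, h2) =
      (p : ℂ)⁻¹ * ZMod.dft (fun x => vertDft p f m x *
        (starRingEnd ℂ) (vertDft p f (m + h2) x)) (-h1) := by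
  have hp : (p : ℂ) ≠ 0 := NeZero.ne _
  have h := sum_dft_mul_conj_dft p (vertDft p f m)
    (fun x => ZMod.stdAddChar (-(x * h1)) * vertDft p f (m + h2) x)
  simp only [← dft_add] at h
  calc
    F2 p f m (h1, h2) = (p : ℂ)⁻¹ ^ 2 * ∑ k, ZMod.dft (vertDft p f m) k *
        (starRingEnd ℂ) (ZMod.dft (vertDft p f (m + h2)) (k + h1)) := by
      simp only [F2, Prod.mk_add_mk, dft_eq_dft_vertDft, map_mul, map_inv₀, map_natCast,
        Finset.mul_sum]
      refine Finset.sum_congr rfl fun k _ => ?_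
      ring
    _ = _ := by
      rw [h, ZMod.dft_apply, ← mul_assoc]
      congr 1
      · field_simp
      · refine Finset.sum_congr rfl fun x _ => ?_
        simp only [map_mul, ← AddChar.map_neg_eq_conj, smul_eq_mul, mul_neg]
        ring

lemma sum_norm_F2_sq (f : ZMod p × ZMod p → ℂ) (m h2 : ZMod p) :
    ∑ h1, ‖F2 p f m (h1, h2)‖ ^ 2 =
      (p : ℝ)⁻¹ * ∑ x, ‖vertDft p f m x‖ ^ 2 * ‖vertDft p f (m + h2) x‖ ^ 2 := by
  have hp : (p : ℝ) ≠ 0 := NeZero.ne _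
  simp only [F2_eq, norm_mul, mul_pow, norm_inv, Complex.norm_natCast]
  have hneg (g : ZMod p → ℂ) : ∑ k, ‖ZMod.dft g (-k)‖ ^ 2 = ∑ k, ‖ZMod.dft g k‖ ^ 2 :=
    Equiv.sum_comp (Equiv.neg (ZMod p)) fun k => ‖ZMod.dft g k‖ ^ 2
  rw [← Finset.mul_sum, hneg, sum_norm_dft_sq]
  simp only [norm_mul, mul_pow, RCLike.norm_conj]
  field_simp

lemma sum_norm_vertDft_sq_le_one {f : ZMod p × ZMod p → ℂ} (hf : OneBounded f) (x : ZMod p) :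
    ∑ m, ‖vertDft p f m x‖ ^ 2 ≤ 1 := by
  have hp : (0 : ℝ) < p := Nat.cast_pos.2 (NeZero.pos p)
  simp only [vertDft, norm_mul, mul_pow, norm_inv, Complex.norm_natCast]
  rw [← Finset.mul_sum, sum_norm_dft_sq]
  have h : ∑ y, ‖f (x, y)‖ ^ 2 ≤ (p : ℝ) := by
    calc
      _ ≤ ∑ _y : ZMod p, (1 : ℝ) :=
        Finset.sum_le_sum fun y _ => pow_le_one₀ (norm_nonneg _) (hf _)
      _ = p := by simp [ZMod.card]
  calc
    _ ≤ ((p : ℝ)⁻¹) ^ 2 * (p * p) := by gcongr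
    _ = 1 := by field_simp

/-- The Fourier expression of the `U²` norm on `ZMod p`. -/
lemma sum_norm_dft_pow_four (g : ZMod p → ℂ) :
    ((∑ k, ‖ZMod.dft g k‖ ^ 4 : ℝ) : ℂ) =
      p * ∑ x, ∑ h, ∑ k, g x * (starRingEnd ℂ) (g (x + h)) * (starRingEnd ℂ) (g (x + k)) *
        g (x + (h + k)) := by
  have hdft (k : ZMod p) :
      ZMod.dft (fun h => ∑ x, g x * (starRingEnd ℂ) (g (x + h))) (-k) =
        ((‖ZMod.dft g k‖ ^ 2 : ℝ) : ℂ) := by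
    rw [Complex.ofReal_pow, ← Complex.mul_conj']
    simp only [ZMod.dft_apply, smul_eq_mul, map_sum, map_mul, ← AddChar.map_neg_eq_conj, neg_neg,
      Finset.sum_mul_sum]
    simp only [Finset.mul_sum]
    rw [Finset.sum_comm]
    refine Finset.sum_congr rfl fun x _ => ?_
    refine Fintype.sum_equiv (Equiv.addLeft x) _ _ fun h => ?_
    rw [Equiv.coe_addLeft, show -(h * -k) = -(x * k) + (x + h) * k by ring,
      AddChar.map_add_eq_mul]
    ring
  have h := sum_norm_dft_sq p (fun h => ∑ x, g x * (starRingEnd ℂ) (g (x + h)))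
  rw [← Equiv.sum_comp (Equiv.neg (ZMod p))] at h
  simp only [Equiv.neg_apply, hdft, Complex.norm_real, norm_pow, norm_norm, ← pow_mul] at h
  norm_num only at h
  rw [h]
  push_cast
  simp only [← Complex.mul_conj', map_sum, map_mul, Complex.conj_conj, Finset.sum_mul_sum]
  congr 1
  rw [Finset.sum_comm]
  refine Finset.sum_congr rfl fun x _ => Finset.sum_congr rfl fun h _ => ?_
  rw [← Equiv.sum_comp (Equiv.addLeft x)]
  refine Finset.sum_congr rfl fun k _ => ?_
  rw [Equiv.coe_addLeft, show x + k + h = x + (h + k) by ring]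
  ring

lemma U2vert_sq_sq (f : ZMod p × ZMod p → ℂ) :
    (U2vert p f ^ 2) ^ 2 = (p : ℝ)⁻¹ * ∑ x, ∑ m, ‖vertDft p f m x‖ ^ 4 := by
  have hp : (p : ℂ) ≠ 0 := NeZero.ne _
  have key : (p : ℝ)⁻¹ ^ 4 * (∑ x : ZMod p × ZMod p, ∑ h : ZMod p, ∑ k : ZMod p,
      f x * (starRingEnd ℂ) (f (x + (0, h))) * (starRingEnd ℂ) (f (x + (0, k))) *
        f (x + (0, h + k))).re = (p : ℝ)⁻¹ * ∑ x, ∑ m, ‖vertDft p f m x‖ ^ 4 := by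
    have hsum : ∑ x : ZMod p × ZMod p, ∑ h : ZMod p, ∑ k : ZMod p,
        f x * (starRingEnd ℂ) (f (x + (0, h))) * (starRingEnd ℂ) (f (x + (0, k))) *
          f (x + (0, h + k)) =
        (((p : ℝ)⁻¹ * ∑ x, ∑ k, ‖ZMod.dft (fun y => f (x, y)) k‖ ^ 4 : ℝ) : ℂ) := by
      rw [Complex.ofReal_mul, Complex.ofReal_sum, Fintype.sum_prod_type, Finset.mul_sum]
      refine Finset.sum_congr rfl fun x _ => ?_
      rw [sum_norm_dft_pow_four]
      simp [hp]
    rw [hsum, Complex.ofReal_re]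
    simp only [vertDft, norm_mul, mul_pow, norm_inv, Complex.norm_natCast, ← Finset.mul_sum]
    ring
  rw [U2vert, key, ← pow_mul, ← Real.rpow_natCast, ← Real.rpow_mul (by positivity)]
  norm_num

lemma sum_norm_F2_sq_le_U2vert (f : ZMod p × ZMod p → ℂ) (h : ZMod p × ZMod p) :
    ∑ m, ‖F2 p f m h‖ ^ 2 ≤ (U2vert p f ^ 2) ^ 2 := by
  obtain ⟨h1, h2⟩ := h
  calc
    ∑ m, ‖F2 p f m (h1, h2)‖ ^ 2
      ≤ ∑ m, (p : ℝ)⁻¹ * ∑ x, ‖vertDft p f m x‖ ^ 2 * ‖vertDft p f (m + h2) x‖ ^ 2 := by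
        refine Finset.sum_le_sum fun m _ => ?_
        rw [← sum_norm_F2_sq]
        exact Finset.single_le_sum (f := fun h1 => ‖F2 p f m (h1, h2)‖ ^ 2)
          (fun _ _ => by positivity) (Finset.mem_univ h1)
    _ = (p : ℝ)⁻¹ * ∑ x, ∑ m, ‖vertDft p f m x‖ ^ 2 * ‖vertDft p f (m + h2) x‖ ^ 2 := by
        rw [← Finset.mul_sum, Finset.sum_comm]
    _ ≤ (p : ℝ)⁻¹ * ∑ x, ∑ m, ‖vertDft p f m x‖ ^ 4 := by
        refine mul_le_mul_of_nonneg_left (Finset.sum_le_sum fun x _ => ?_) (by positivity)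
        calc
          _ ≤ ∑ m, (‖vertDft p f m x‖ ^ 4 + ‖vertDft p f (m + h2) x‖ ^ 4) / 2 :=
            Finset.sum_le_sum fun m _ => by
              nlinarith [sq_nonneg (‖vertDft p f m x‖ ^ 2 - ‖vertDft p f (m + h2) x‖ ^ 2)]
          _ = ∑ m, ‖vertDft p f m x‖ ^ 4 := by
            have hshift : ∑ m, ‖vertDft p f (m + h2) x‖ ^ 4 = ∑ m, ‖vertDft p f m x‖ ^ 4 :=
              Equiv.sum_comp (Equiv.addRight h2) fun m => ‖vertDft p f m x‖ ^ 4
            rw [← Finset.sum_div, Finset.sum_add_distrib, hshift]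
            ring
    _ = _ := (U2vert_sq_sq p f).symm

lemma sum_sum_norm_F2_sq_le_one {f : ZMod p × ZMod p → ℂ} (hf : OneBounded f) :
    ∑ h : ZMod p × ZMod p, ∑ m, ‖F2 p f m h‖ ^ 2 ≤ 1 := by
  have hp : (p : ℝ) ≠ 0 := NeZero.ne _
  calc
    ∑ h : ZMod p × ZMod p, ∑ m, ‖F2 p f m h‖ ^ 2
      = ∑ m, ∑ h2, ∑ h1, ‖F2 p f m (h1, h2)‖ ^ 2 := by
        rw [Finset.sum_comm]
        simp only [Fintype.sum_prod_type_right]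
    _ = (p : ℝ)⁻¹ * ∑ x, (∑ m, ‖vertDft p f m x‖ ^ 2) * ∑ m, ‖vertDft p f m x‖ ^ 2 := by
        simp only [sum_norm_F2_sq, ← Finset.mul_sum]
        congr 1
        rw [Finset.sum_congr rfl fun m _ => Finset.sum_comm, Finset.sum_comm]
        refine Finset.sum_congr rfl fun x _ => ?_
        rw [Finset.sum_mul]
        refine Finset.sum_congr rfl fun m _ => ?_
        rw [← Finset.mul_sum, ← Equiv.sum_comp (Equiv.addLeft m) (fun k => ‖vertDft p f k x‖ ^ 2)]
        rfl
    _ ≤ (p : ℝ)⁻¹ * ∑ _x : ZMod p, 1 := by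
        gcongr with x
        have h := sum_norm_vertDft_sq_le_one p hf x
        exact mul_le_one₀ h (by positivity) h
    _ = 1 := by simp [ZMod.card, hp]

/-- **Proposition 3.5.** Gowers box norm bound for the product of two copies of `F₂`. -/
theorem F2_gowers_bound (p : ℕ) [Fact p.Prime] (f2 : ZMod p × ZMod p → ℂ)
    (hf2 : OneBounded f2) :
    (∑ m2 : ZMod p, ∑ m2' : ZMod p, ∑ h : ZMod p × ZMod p,
        ‖(starRingEnd ℂ) (F2 p f2 m2 h) * F2 p f2 m2' h‖ ^ 2) ^ ((2:ℝ)⁻¹) ≤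
      U2vert p f2 ^ 2 := by
  rw [← one_div, ← Real.sqrt_eq_rpow]
  refine Real.sqrt_le_iff.2 ⟨by positivity, ?_⟩
  calc
    _ = ∑ h : ZMod p × ZMod p, (∑ m, ‖F2 p f2 m h‖ ^ 2) * ∑ m, ‖F2 p f2 m h‖ ^ 2 := by
      rw [Finset.sum_congr rfl fun m _ => Finset.sum_comm, Finset.sum_comm]
      simp only [norm_mul, mul_pow, RCLike.norm_conj, Finset.sum_mul_sum]
    _ ≤ ∑ h : ZMod p × ZMod p, (U2vert p f2 ^ 2) ^ 2 * ∑ m, ‖F2 p f2 m h‖ ^ 2 := by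
      gcongr with h
      exact sum_norm_F2_sq_le_U2vert p f2 h
    _ = (U2vert p f2 ^ 2) ^ 2 * ∑ h : ZMod p × ZMod p, ∑ m, ‖F2 p f2 m h‖ ^ 2 :=
      (Finset.mul_sum ..).symm
    _ ≤ (U2vert p f2 ^ 2) ^ 2 :=
      mul_le_of_le_one_right (by positivity) (sum_sum_norm_F2_sq_le_one p hf2)

end RatCorners
end
end

section
/- There exists a constant C > 0 depending only on P and Q such that for every admissible prime p and all 1-bounded functions f0, f1, f2 : F_p^2 → ℂ, one has |𝔼_{x1,x2,y} f0(x1,x2) f1(x1+P(y),x2) f2(x1,x2+Q(y))| ≤ ‖f0‖_2 · ‖f1‖_4^{1/2} · ‖f1‖_{U^2(F_p×0)}^{1/4} · ‖f2‖_4 · ( |Y(F_p)| / p^6 )^{1/16}, where Y(F_p) is the set of F_p-points of the Roth variety for corners associated to P, Q. -/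
open scoped BigOperators ComplexOrder
open Polynomial

noncomputable section

namespace RatCorners

variable (p : ℕ) [NeZero p]

/-- The unnormalized Fourier transform on `ZMod p`. -/
def charSum (u : ZMod p → ℂ) (t : ZMod p) : ℂ := ∑ x, u x * ZMod.stdAddChar (t * x)

theorem sum_stdAddChar_mul (b : ZMod p) :
    ∑ t : ZMod p, ZMod.stdAddChar (t * b) = if b = 0 then (p : ℂ) else 0 := by
  simpa using AddChar.sum_mulShift b (ZMod.isPrimitive_stdAddChar p)

theorem conj_stdAddChar (x : ZMod p) :
    (starRingEnd ℂ) (ZMod.stdAddChar x) = ZMod.stdAddChar (-x) :=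
  (AddChar.map_neg_eq_conj _ _).symm

/-- Parseval's identity on `ZMod p`. -/
theorem sum_norm_charSum_sq (u : ZMod p → ℂ) :
    ∑ t, ‖charSum p u t‖ ^ 2 = p * ∑ x, ‖u x‖ ^ 2 := by
  have h : ∀ t, ((‖charSum p u t‖ ^ 2 : ℝ) : ℂ) =
      ∑ x, ∑ x', u x * (starRingEnd ℂ) (u x') * ZMod.stdAddChar (t * (x - x')) := by
    intro t
    rw [Complex.ofReal_pow, ← Complex.mul_conj', charSum, map_sum, Finset.sum_mul_sum]
    refine Finset.sum_congr rfl fun x _ => Finset.sum_congr rfl fun x' _ => ?_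
    rw [map_mul (starRingEnd ℂ), conj_stdAddChar, mul_sub, sub_eq_add_neg, AddChar.map_add_eq_mul]
    ring
  rw [← Complex.ofReal_inj, Complex.ofReal_sum]
  simp_rw [h]
  rw [Finset.sum_comm]
  simp_rw [Finset.sum_comm (s := (Finset.univ : Finset (ZMod p))) (t := Finset.univ)
    (f := fun t x' => u _ * (starRingEnd ℂ) (u x') * ZMod.stdAddChar (t * (_ - x'))),
    ← Finset.mul_sum, sum_stdAddChar_mul, sub_eq_zero, mul_ite, mul_zero,
    Finset.sum_ite_eq, Finset.mem_univ, if_true, Complex.mul_conj']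
  push_cast
  rw [← Finset.sum_mul, mul_comm]

/-- Fourier inversion on `ZMod p`. -/
theorem sum_charSum_mul_stdAddChar (u : ZMod p → ℂ) (x : ZMod p) :
    ∑ n, charSum p u n * ZMod.stdAddChar (-(n * x)) = p * u x := by
  simp_rw [charSum, Finset.sum_mul]
  rw [Finset.sum_comm]
  have h : ∀ y n : ZMod p, u y * ZMod.stdAddChar (n * y) * ZMod.stdAddChar (-(n * x)) =
      u y * ZMod.stdAddChar (n * (y - x)) := by
    intro y n
    rw [mul_sub, sub_eq_add_neg, AddChar.map_add_eq_mul, mul_assoc]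
  simp_rw [h, ← Finset.mul_sum, sum_stdAddChar_mul, sub_eq_zero, mul_ite, mul_zero,
    Finset.sum_ite_eq', Finset.mem_univ, if_true]
  ring

/-- The autocorrelation `h ↦ ∑ₓ u(x) conj u(x+h)`. -/
def autocorr (u : ZMod p → ℂ) (h : ZMod p) : ℂ := ∑ x, u x * (starRingEnd ℂ) (u (x + h))

theorem norm_charSum_autocorr (u : ZMod p → ℂ) (n : ZMod p) :
    ‖charSum p (autocorr p u) n‖ = ‖charSum p u (-n)‖ ^ 2 := by
  have : charSum p (autocorr p u) n =
      charSum p u (-n) * (starRingEnd ℂ) (charSum p u (-n)) := by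
    simp_rw [charSum, autocorr, Finset.sum_mul]
    rw [Finset.sum_comm]
    refine Finset.sum_congr rfl fun x _ => ?_
    rw [map_sum, Finset.mul_sum]
    refine Fintype.sum_equiv (Equiv.addLeft x) _ _ fun h => ?_
    rw [map_mul (starRingEnd ℂ), conj_stdAddChar, Equiv.coe_addLeft,
      show n * h = -n * x + -(-n * (x + h)) by ring, AddChar.map_add_eq_mul]
    ring
  rw [this, Complex.mul_conj', norm_pow, Complex.norm_real, norm_norm]

theorem sum_norm_charSum_pow_four (u : ZMod p → ℂ) :
    ∑ n, ‖charSum p u n‖ ^ 4 = p * ∑ h, ‖autocorr p u h‖ ^ 2 := by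
  rw [← sum_norm_charSum_sq, ← Equiv.sum_comp (Equiv.neg (ZMod p)) fun n => ‖charSum p u n‖ ^ 4]
  simp_rw [norm_charSum_autocorr, ← pow_mul, Equiv.neg_apply]

/-- `U²(F_p × 0)` in terms of fibrewise Fourier transforms. -/
theorem U2horiz_pow_four (f : ZMod p × ZMod p → ℂ) :
    0 ≤ U2horiz p f ∧
      (p : ℝ) ^ 5 * U2horiz p f ^ 4 = ∑ y, ∑ n, ‖charSum p (fun x => f (x, y)) n‖ ^ 4 := by
  have hsum : ∑ y, ∑ h, ‖autocorr p (fun x => f (x, y)) h‖ ^ 2 =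
      (∑ x : ZMod p × ZMod p, ∑ h : ZMod p, ∑ k : ZMod p,
        f x * (starRingEnd ℂ) (f (x + (h, 0))) * (starRingEnd ℂ) (f (x + (k, 0))) *
        f (x + (h + k, 0))).re := by
    have h1 : ∀ y h, ((‖autocorr p (fun x => f (x, y)) h‖ ^ 2 : ℝ) : ℂ) = ∑ x, ∑ k,
        f (x, y) * (starRingEnd ℂ) (f ((x, y) + (h, 0))) *
          (starRingEnd ℂ) (f ((x, y) + (k, 0))) * f ((x, y) + (h + k, 0)) := by
      intro y h
      rw [Complex.ofReal_pow, ← Complex.mul_conj', autocorr, map_sum, Finset.sum_mul_sum]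
      refine Finset.sum_congr rfl fun x _ => ?_
      conv_lhs => rw [← Equiv.sum_comp (Equiv.addLeft x)]
      refine Finset.sum_congr rfl fun k _ => ?_
      simp only [map_mul, Complex.conj_conj, Equiv.coe_addLeft, Prod.mk_add_mk, add_zero,
        add_right_comm x k h, ← add_assoc, mul_assoc]
    rw [← Complex.ofReal_re (∑ y, ∑ h, ‖autocorr p (fun x => f (x, y)) h‖ ^ 2)]
    congr 1
    simp_rw [Complex.ofReal_sum, h1]
    rw [Fintype.sum_prod_type_right]
    exact Finset.sum_congr rfl fun y _ => Finset.sum_comm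
  have hp : (0 : ℝ) < p := Nat.cast_pos.mpr (NeZero.pos p)
  have hnn : (0 : ℝ) ≤ (p : ℝ)⁻¹ ^ 4 *
      ∑ y, ∑ h, ‖autocorr p (fun x => f (x, y)) h‖ ^ 2 := by positivity
  refine ⟨by rw [U2horiz, ← hsum]; positivity, ?_⟩
  simp_rw [sum_norm_charSum_pow_four, ← Finset.mul_sum]
  rw [U2horiz, ← hsum, ← Real.rpow_natCast (_ ^ _), ← Real.rpow_mul hnn]
  norm_num
  field_simp

/-- The Fourier coefficient `∑_y g_n(y) conj g_{n+s}(y) e_p(ty)`, where `g_n(y)` is the `n`-th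
Fourier coefficient of the fibre `f y`. -/
def fibreCorr (f : ZMod p → ZMod p → ℂ) (n s t : ZMod p) : ℂ :=
  charSum p (fun y => charSum p (f y) n * (starRingEnd ℂ) (charSum p (f y) (n + s))) t

theorem sum_norm_fibreCorr_sq (f : ZMod p → ZMod p → ℂ) (n s : ZMod p) :
    ∑ t, ‖fibreCorr p f n s t‖ ^ 2 =
      p * ∑ y, ‖charSum p (f y) n‖ ^ 2 * ‖charSum p (f y) (n + s)‖ ^ 2 := by
  simp_rw [fibreCorr, sum_norm_charSum_sq, norm_mul, mul_pow, RCLike.norm_conj]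

theorem sum_norm_fibreCorr_sq_le_pow_four (f : ZMod p → ZMod p → ℂ) (s t : ZMod p) :
    ∑ n, ‖fibreCorr p f n s t‖ ^ 2 ≤ p * ∑ y, ∑ n, ‖charSum p (f y) n‖ ^ 4 := by
  calc ∑ n, ‖fibreCorr p f n s t‖ ^ 2
      ≤ ∑ n, ∑ t, ‖fibreCorr p f n s t‖ ^ 2 := Finset.sum_le_sum fun n _ =>
        Finset.single_le_sum (f := fun t => ‖fibreCorr p f n s t‖ ^ 2)
          (fun _ _ => by positivity) (Finset.mem_univ t)
    _ = p * ∑ y, ∑ n, ‖charSum p (f y) n‖ ^ 2 * ‖charSum p (f y) (n + s)‖ ^ 2 := by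
        simp_rw [sum_norm_fibreCorr_sq, ← Finset.mul_sum]
        rw [Finset.sum_comm]
    _ ≤ p * ∑ y, ∑ n, (‖charSum p (f y) n‖ ^ 4 + ‖charSum p (f y) (n + s)‖ ^ 4) / 2 := by
        gcongr with y _ n _
        nlinarith [sq_nonneg (‖charSum p (f y) n‖ ^ 2 - ‖charSum p (f y) (n + s)‖ ^ 2)]
    _ = p * ∑ y, ∑ n, ‖charSum p (f y) n‖ ^ 4 := by
        congr 1
        refine Finset.sum_congr rfl fun y _ => ?_
        have h : ∑ n, ‖charSum p (f y) (n + s)‖ ^ 4 = ∑ n, ‖charSum p (f y) n‖ ^ 4 :=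
          Equiv.sum_comp (Equiv.addRight s) fun n => ‖charSum p (f y) n‖ ^ 4
        rw [← Finset.sum_div, Finset.sum_add_distrib, h]
        ring

theorem sum_sum_norm_fibreCorr_sq_le (f : ZMod p → ZMod p → ℂ) :
    ∑ s, ∑ t, ∑ n, ‖fibreCorr p f n s t‖ ^ 2 ≤ (p : ℝ) ^ 4 * ∑ y, ∑ x, ‖f y x‖ ^ 4 := by
  calc ∑ s, ∑ t, ∑ n, ‖fibreCorr p f n s t‖ ^ 2
      = p * ∑ y, (∑ n, ‖charSum p (f y) n‖ ^ 2) ^ 2 := by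
        have h : ∀ s, ∑ t, ∑ n, ‖fibreCorr p f n s t‖ ^ 2 =
            p * ∑ y, ∑ n, ‖charSum p (f y) n‖ ^ 2 * ‖charSum p (f y) (n + s)‖ ^ 2 := by
          intro s
          rw [Finset.sum_comm]
          simp_rw [sum_norm_fibreCorr_sq, ← Finset.mul_sum]
          rw [Finset.sum_comm]
        simp_rw [h, ← Finset.mul_sum]
        rw [Finset.sum_comm]
        congr 1
        refine Finset.sum_congr rfl fun y _ => ?_
        rw [Finset.sum_comm, sq, Finset.sum_mul]
        refine Finset.sum_congr rfl fun n _ => ?_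
        rw [← Finset.mul_sum]
        congr 1
        exact Equiv.sum_comp (Equiv.addLeft n) fun m => ‖charSum p (f y) m‖ ^ 2
    _ = (p : ℝ) ^ 3 * ∑ y, (∑ x, ‖f y x‖ ^ 2) ^ 2 := by
        simp_rw [sum_norm_charSum_sq, mul_pow, ← Finset.mul_sum]
        ring
    _ ≤ (p : ℝ) ^ 3 * ∑ y, (p * ∑ x, ‖f y x‖ ^ 4) := by
        gcongr with y _
        have := sq_sum_le_card_mul_sum_sq (s := Finset.univ) (f := fun x => ‖f y x‖ ^ 2)
        simpa [← pow_mul, ZMod.card] using this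
    _ = (p : ℝ) ^ 4 * ∑ y, ∑ x, ‖f y x‖ ^ 4 := by
        rw [← Finset.mul_sum]
        ring

/-- The exponential sum `∑_{y ∈ S} e_p(-(n P(y) + m Q(y)))`. -/
def expSum (S : Finset (ZMod p)) (P Q : ZMod p → ZMod p) (n m : ZMod p) : ℂ :=
  ∑ y ∈ S, ZMod.stdAddChar (-(n * P y + m * Q y))

theorem conj_expSum (S : Finset (ZMod p)) (P Q : ZMod p → ZMod p) (n m : ZMod p) :
    (starRingEnd ℂ) (expSum p S P Q n m) = ∑ y ∈ S, ZMod.stdAddChar (n * P y + m * Q y) := by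
  simp_rw [expSum, map_sum, conj_stdAddChar, neg_neg]

/-- The differenced kernel `K(n,m) conj K(n+s,m+t)`, where `K` is `expSum`. -/
def diffKernel (S : Finset (ZMod p)) (P Q : ZMod p → ZMod p) (s t n m : ZMod p) : ℂ :=
  expSum p S P Q n m * (starRingEnd ℂ) (expSum p S P Q (n + s) (m + t))

theorem sum_corner_eq_sum_expSum (S : Finset (ZMod p)) (P Q : ZMod p → ZMod p)
    (f g : ZMod p → ZMod p → ℂ) (x y : ZMod p) :
    (p : ℂ) ^ 2 * ∑ z ∈ S, f y (x + P z) * g x (y + Q z) =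
      ∑ n, ∑ m, charSum p (f y) n * charSum p (g x) m * ZMod.stdAddChar (-(n * x + m * y)) *
        expSum p S P Q n m := by
  have h : ∀ z, (p : ℂ) ^ 2 * (f y (x + P z) * g x (y + Q z)) =
      ∑ n, ∑ m, charSum p (f y) n * charSum p (g x) m * ZMod.stdAddChar (-(n * x + m * y)) *
        ZMod.stdAddChar (-(n * P z + m * Q z)) := by
    intro z
    rw [show (p : ℂ) ^ 2 * (f y (x + P z) * g x (y + Q z)) =
      (p * f y (x + P z)) * (p * g x (y + Q z)) by ring, ← sum_charSum_mul_stdAddChar,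
      ← sum_charSum_mul_stdAddChar, Finset.sum_mul_sum]
    refine Finset.sum_congr rfl fun n _ => Finset.sum_congr rfl fun m _ => ?_
    rw [mul_mul_mul_comm, ← AddChar.map_add_eq_mul, mul_assoc (_ * _), ← AddChar.map_add_eq_mul]
    congr 2
    ring
  simp_rw [Finset.mul_sum, h, expSum, Finset.mul_sum]
  rw [Finset.sum_comm]
  exact Finset.sum_congr rfl fun n _ => Finset.sum_comm

theorem sum_norm_corner_sq (S : Finset (ZMod p)) (P Q : ZMod p → ZMod p)
    (f g : ZMod p → ZMod p → ℂ) :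
    (p : ℂ) ^ 4 * ((∑ x, ∑ y, ‖∑ z ∈ S, f y (x + P z) * g x (y + Q z)‖ ^ 2 : ℝ) : ℂ) =
      ∑ s, ∑ t, ∑ n, ∑ m, fibreCorr p f n s t * fibreCorr p g m t s *
        diffKernel p S P Q s t n m := by
  let W (x y n m : ZMod p) : ℂ := charSum p (f y) n * charSum p (g x) m *
    ZMod.stdAddChar (-(n * x + m * y)) * expSum p S P Q n m
  have hl : ∀ x y, (p : ℂ) ^ 4 *
      ((‖∑ z ∈ S, f y (x + P z) * g x (y + Q z)‖ ^ 2 : ℝ) : ℂ) =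
      ∑ n, ∑ n', ∑ m, ∑ m', W x y n m * (starRingEnd ℂ) (W x y n' m') := by
    intro x y
    have : ∀ w : ℂ, (p : ℂ) ^ 4 * ((‖w‖ ^ 2 : ℝ) : ℂ) =
        ((p : ℂ) ^ 2 * w) * (starRingEnd ℂ) ((p : ℂ) ^ 2 * w) := by
      intro w
      rw [Complex.ofReal_pow, ← Complex.mul_conj', map_mul, map_pow, Complex.conj_natCast]
      ring
    rw [this, sum_corner_eq_sum_expSum]
    simp_rw [map_sum, Finset.sum_mul_sum]
    rfl
  have hr : ∀ s t n m, fibreCorr p f n s t * fibreCorr p g m t s *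
      diffKernel p S P Q s t n m =
      ∑ y, ∑ x, W x y n m * (starRingEnd ℂ) (W x y (n + s) (m + t)) := by
    intro s t n m
    rw [fibreCorr, fibreCorr, charSum, charSum, Finset.sum_mul_sum, Finset.sum_mul]
    refine Finset.sum_congr rfl fun y _ => ?_
    rw [Finset.sum_mul]
    refine Finset.sum_congr rfl fun x _ => ?_
    have : (ZMod.stdAddChar (t * y) * ZMod.stdAddChar (s * x) : ℂ) =
        ZMod.stdAddChar (-(n * x + m * y)) *
          ZMod.stdAddChar ((n + s) * x + (m + t) * y) := by
      rw [← AddChar.map_add_eq_mul, ← AddChar.map_add_eq_mul]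
      congr 1
      ring
    simp only [W, diffKernel, map_mul, conj_stdAddChar, neg_neg]
    linear_combination (charSum p (f y) n * (starRingEnd ℂ) (charSum p (f y) (n + s)) *
      charSum p (g x) m * (starRingEnd ℂ) (charSum p (g x) (m + t)) *
      expSum p S P Q n m * (starRingEnd ℂ) (expSum p S P Q (n + s) (m + t))) * this
  simp_rw [Complex.ofReal_sum, Finset.mul_sum, hl, hr]
  simp only [← Fintype.sum_prod_type']
  refine (Fintype.sum_equiv
    { toFun := fun a => (a.2.2.2.2.2, a.2.2.2.2.1, a.2.2.1, a.2.2.1 + a.1, a.2.2.2.1,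
        a.2.2.2.1 + a.2.1)
      invFun := fun b => (b.2.2.2.1 - b.2.2.1, b.2.2.2.2.2 - b.2.2.2.2.1, b.2.2.1,
        b.2.2.2.2.1, b.2.1, b.1)
      left_inv := fun a => by simp
      right_inv := fun b => by simp } _ _ fun a => rfl).symm

/-- The Gram matrix `L L*`. -/
def gram {ι κ : Type*} [Fintype κ] (L : ι → κ → ℂ) (i k : ι) : ℂ :=
  ∑ m, L i m * (starRingEnd ℂ) (L k m)

theorem norm_sum_mul_sq_le {ι : Type*} [Fintype ι] (u v : ι → ℂ) :
    ‖∑ i, u i * v i‖ ^ 2 ≤ (∑ i, ‖u i‖ ^ 2) * ∑ i, ‖v i‖ ^ 2 := by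
  calc ‖∑ i, u i * v i‖ ^ 2 ≤ (∑ i, ‖u i‖ * ‖v i‖) ^ 2 := by
        gcongr
        exact (norm_sum_le _ _).trans_eq (by simp_rw [norm_mul])
    _ ≤ _ := Finset.sum_mul_sq_le_sq_mul_sq _ _ _

theorem sum_norm_vecMul_sq_sq_le {ι κ : Type*} [Fintype ι] [Fintype κ]
    (L : ι → κ → ℂ) (u : ι → ℂ) :
    (∑ m, ‖∑ i, u i * L i m‖ ^ 2) ^ 2 ≤
      (∑ i, ‖u i‖ ^ 2) * ∑ k, ‖∑ i, u i * gram L i k‖ ^ 2 := by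
  have h : ((∑ m, ‖∑ i, u i * L i m‖ ^ 2 : ℝ) : ℂ) =
      ∑ k, (starRingEnd ℂ) (u k) * ∑ i, u i * gram L i k := by
    simp_rw [Complex.ofReal_sum, Complex.ofReal_pow, ← Complex.mul_conj', map_sum,
      Finset.sum_mul_sum, gram, Finset.mul_sum]
    simp only [← Fintype.sum_prod_type']
    refine Fintype.sum_equiv
      { toFun := fun a => (a.2.2, a.2.1, a.1)
        invFun := fun a => (a.2.2, a.2.1, a.1)
        left_inv := fun a => rfl
        right_inv := fun a => rfl } _ _ fun a => ?_
    simp only [Equiv.coe_fn_mk, map_mul]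
    ring
  have := norm_sum_mul_sq_le (fun k => (starRingEnd ℂ) (u k)) fun k => ∑ i, u i * gram L i k
  rw [← h, Complex.norm_real, Real.norm_eq_abs, sq_abs] at this
  simpa only [RCLike.norm_conj] using this

/-- A bilinear form is bounded by the Schatten `8`-norm of its matrix. -/
theorem norm_bilin_pow_eight_le {ι κ : Type*} [Fintype ι] [Fintype κ]
    (L : ι → κ → ℂ) (u : ι → ℂ) (v : κ → ℂ) :
    ‖∑ i, ∑ m, u i * v m * L i m‖ ^ 8 ≤
      (∑ i, ‖u i‖ ^ 2) ^ 4 * (∑ m, ‖v m‖ ^ 2) ^ 4 *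
        ∑ i, ∑ j, ‖gram (gram L) i j‖ ^ 2 := by
  have h0 : ‖∑ i, ∑ m, u i * v m * L i m‖ ^ 2 ≤
      (∑ m, ‖v m‖ ^ 2) * ∑ m, ‖∑ i, u i * L i m‖ ^ 2 := by
    refine le_of_eq_of_le ?_ (norm_sum_mul_sq_le v fun m => ∑ i, u i * L i m)
    rw [Finset.sum_comm]
    simp_rw [Finset.mul_sum, mul_left_comm, mul_assoc]
  have h1 := sum_norm_vecMul_sq_sq_le L u
  have h2 := sum_norm_vecMul_sq_sq_le (gram L) u
  have h3 : ∑ k, ‖∑ i, u i * gram (gram L) i k‖ ^ 2 ≤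
      (∑ i, ‖u i‖ ^ 2) * ∑ i, ∑ j, ‖gram (gram L) i j‖ ^ 2 := by
    rw [Finset.sum_comm, Finset.mul_sum]
    exact Finset.sum_le_sum fun k _ => norm_sum_mul_sq_le u fun i => gram (gram L) i k
  calc ‖∑ i, ∑ m, u i * v m * L i m‖ ^ 8
      = (‖∑ i, ∑ m, u i * v m * L i m‖ ^ 2) ^ 4 := by ring
    _ ≤ ((∑ m, ‖v m‖ ^ 2) * ∑ m, ‖∑ i, u i * L i m‖ ^ 2) ^ 4 := by gcongr
    _ = (∑ m, ‖v m‖ ^ 2) ^ 4 * ((∑ m, ‖∑ i, u i * L i m‖ ^ 2) ^ 2) ^ 2 := by ring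
    _ ≤ (∑ m, ‖v m‖ ^ 2) ^ 4 *
        ((∑ i, ‖u i‖ ^ 2) * ∑ k, ‖∑ i, u i * gram L i k‖ ^ 2) ^ 2 := by gcongr
    _ = (∑ m, ‖v m‖ ^ 2) ^ 4 * (∑ i, ‖u i‖ ^ 2) ^ 2 *
        (∑ k, ‖∑ i, u i * gram L i k‖ ^ 2) ^ 2 := by ring
    _ ≤ (∑ m, ‖v m‖ ^ 2) ^ 4 * (∑ i, ‖u i‖ ^ 2) ^ 2 *
        ((∑ i, ‖u i‖ ^ 2) * ((∑ i, ‖u i‖ ^ 2) *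
          ∑ i, ∑ j, ‖gram (gram L) i j‖ ^ 2)) := by
        gcongr
        exact h2.trans (by gcongr)
    _ = _ := by ring

theorem sum_mul_mul_pow_eight_le {ι : Type*} [Fintype ι] {a b s : ι → ℝ} {U : ℝ}
    (ha : ∀ i, 0 ≤ a i) (haU : ∀ i, a i ≤ U) :
    (∑ i, a i * b i * s i) ^ 8 ≤
      (∑ i, b i ^ 2) ^ 4 * (∑ i, a i ^ 2) ^ 3 * U ^ 2 * ∑ i, s i ^ 8 := by
  have h1 : (∑ i, a i * b i * s i) ^ 2 ≤ (∑ i, b i ^ 2) * ∑ i, (a i * s i) ^ 2 := by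
    refine le_of_eq_of_le ?_ (Finset.sum_mul_sq_le_sq_mul_sq Finset.univ b fun i => a i * s i)
    simp_rw [mul_left_comm, mul_assoc]
  have h2 : (∑ i, (a i * s i) ^ 2) ^ 2 ≤
      (∑ i, a i ^ 2) * (U * ∑ i, a i * s i ^ 4) := by
    calc (∑ i, (a i * s i) ^ 2) ^ 2 = (∑ i, a i * (a i * s i ^ 2)) ^ 2 := by
          congr 1
          exact Finset.sum_congr rfl fun i _ => by ring
      _ ≤ (∑ i, a i ^ 2) * ∑ i, (a i * s i ^ 2) ^ 2 := Finset.sum_mul_sq_le_sq_mul_sq _ _ _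
      _ ≤ _ := by
          gcongr
          rw [Finset.mul_sum]
          refine Finset.sum_le_sum fun i _ => ?_
          have : 0 ≤ a i * s i ^ 4 := mul_nonneg (ha i) (by positivity)
          nlinarith [mul_le_mul_of_nonneg_right (haU i) this]
  have h3 : (∑ i, a i * s i ^ 4) ^ 2 ≤ (∑ i, a i ^ 2) * ∑ i, s i ^ 8 := by
    refine (Finset.sum_mul_sq_le_sq_mul_sq _ _ _).trans_eq ?_
    simp_rw [← pow_mul]
  calc (∑ i, a i * b i * s i) ^ 8 = ((∑ i, a i * b i * s i) ^ 2) ^ 4 := by ring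
    _ ≤ ((∑ i, b i ^ 2) * ∑ i, (a i * s i) ^ 2) ^ 4 := by gcongr
    _ = (∑ i, b i ^ 2) ^ 4 * ((∑ i, (a i * s i) ^ 2) ^ 2) ^ 2 := by ring
    _ ≤ (∑ i, b i ^ 2) ^ 4 * ((∑ i, a i ^ 2) * (U * ∑ i, a i * s i ^ 4)) ^ 2 := by gcongr
    _ = (∑ i, b i ^ 2) ^ 4 * (∑ i, a i ^ 2) ^ 2 * U ^ 2 * (∑ i, a i * s i ^ 4) ^ 2 := by ring
    _ ≤ (∑ i, b i ^ 2) ^ 4 * (∑ i, a i ^ 2) ^ 2 * U ^ 2 *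
        ((∑ i, a i ^ 2) * ∑ i, s i ^ 8) := by gcongr
    _ = _ := by ring

theorem addChar_map_sum {ι A M : Type*} [AddCommMonoid A] [CommMonoid M] (ψ : AddChar A M)
    (s : Finset ι) (f : ι → A) : ψ (∑ i ∈ s, f i) = ∏ i ∈ s, ψ (f i) :=
  map_prod ψ.toMonoidHom (fun i => Multiplicative.ofAdd (f i)) s

/-- Counting solutions of a linear system through a product of character sums. -/
theorem sum_prod_stdAddChar {ι κ α : Type*} [Fintype ι] [DecidableEq ι] [Fintype κ]
    [DecidableEq κ] [DecidableEq α] (S : Finset α) (θ : (κ → ZMod p) → ι → α → ZMod p)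
    (l : κ → (ι → α) → ZMod p) (h : ∀ c y, ∑ i, θ c i (y i) = ∑ j, c j * l j y) :
    ∑ c : κ → ZMod p, ∏ i, ∑ y ∈ S, (ZMod.stdAddChar (θ c i y) : ℂ) =
      (p : ℂ) ^ Fintype.card κ *
        ((Fintype.piFinset fun _ : ι => S).filter fun y => ∀ j, l j y = 0).card := by
  simp_rw [Finset.prod_univ_sum]
  rw [Finset.sum_comm, Finset.card_filter, Nat.cast_sum, Finset.mul_sum]
  refine Finset.sum_congr rfl fun y _ => ?_
  calc ∑ c : κ → ZMod p, ∏ i, (ZMod.stdAddChar (θ c i (y i)) : ℂ)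
      = ∑ c : κ → ZMod p, ∏ j, ZMod.stdAddChar (c j * l j y) := by
        refine Finset.sum_congr rfl fun c _ => ?_
        rw [← addChar_map_sum, h, addChar_map_sum]
    _ = ∏ j, ∑ t : ZMod p, ZMod.stdAddChar (t * l j y) := by
        rw [Finset.prod_univ_sum, Fintype.piFinset_univ]
    _ = _ := by
        simp_rw [sum_stdAddChar_mul]
        by_cases hy : ∀ j, l j y = 0
        · simp [hy]
        · obtain ⟨j, hj⟩ := not_forall.mp hy
          rw [Finset.prod_eq_zero (Finset.mem_univ j) (if_neg hj), if_neg hy]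
          simp

theorem sum_fin_succ_fun {α : Type*} [Fintype α] (n : ℕ) (F : (Fin (n + 1) → α) → ℂ) :
    ∑ c, F c = ∑ a, ∑ c, F (Matrix.vecCons a c) := by
  rw [← (Fin.consEquiv fun _ => α).sum_comp, Fintype.sum_prod_type]
  rfl

/-- The linear forms whose common zeros define the Roth variety, up to sign. -/
def rothForm (P Q : ZMod p → ZMod p) : Fin 10 → (Fin 16 → ZMod p) → ZMod p :=
  ![fun y => P (y 8) - P (y 9) - P (y 10) + P (y 11) - P (y 12) + P (y 13) + P (y 14) - P (y 15),
    fun y => Q (y 8) - Q (y 9) - Q (y 10) + Q (y 11) - Q (y 12) + Q (y 13) + Q (y 14) - Q (y 15),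
    fun y => -(P (y 0) - P (y 2) - P (y 8) + P (y 10)),
    fun y => -(P (y 5) - P (y 7) - P (y 13) + P (y 15)),
    fun y => P (y 1) - P (y 3) - P (y 9) + P (y 11),
    fun y => P (y 4) - P (y 6) - P (y 12) + P (y 14),
    fun y => -(Q (y 0) - Q (y 1) - Q (y 8) + Q (y 9)),
    fun y => Q (y 2) - Q (y 6) - Q (y 10) + Q (y 14),
    fun y => -(Q (y 3) - Q (y 7) - Q (y 11) + Q (y 15)),
    fun y => Q (y 4) - Q (y 5) - Q (y 12) + Q (y 13)]

/-- The phases of the sixteen exponential sums making up the Schatten norm of `diffKernel`. -/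
def rothPhase (P Q : ZMod p → ZMod p) (c : Fin 10 → ZMod p) : Fin 16 → ZMod p → ZMod p :=
  ![fun y => -(c 2 * P y + c 6 * Q y), fun y => c 4 * P y + c 6 * Q y,
    fun y => c 2 * P y + c 7 * Q y, fun y => -(c 4 * P y + c 8 * Q y),
    fun y => c 5 * P y + c 9 * Q y, fun y => -(c 3 * P y + c 9 * Q y),
    fun y => -(c 5 * P y + c 7 * Q y), fun y => c 3 * P y + c 8 * Q y,
    fun y => (c 2 + c 0) * P y + (c 6 + c 1) * Q y,
    fun y => -((c 4 + c 0) * P y + (c 6 + c 1) * Q y),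
    fun y => -((c 2 + c 0) * P y + (c 7 + c 1) * Q y),
    fun y => (c 4 + c 0) * P y + (c 8 + c 1) * Q y,
    fun y => -((c 5 + c 0) * P y + (c 9 + c 1) * Q y),
    fun y => (c 3 + c 0) * P y + (c 9 + c 1) * Q y,
    fun y => (c 5 + c 0) * P y + (c 7 + c 1) * Q y,
    fun y => -((c 3 + c 0) * P y + (c 8 + c 1) * Q y)]

theorem sum_rothPhase (P Q : ZMod p → ZMod p) (c : Fin 10 → ZMod p) (y : Fin 16 → ZMod p) :
    ∑ i, rothPhase p P Q c i (y i) = ∑ j, c j * rothForm p P Q j y := by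
  simp [rothPhase, rothForm, Fin.sum_univ_succ]
  ring

theorem prod_fin_sixteen (F : Fin 16 → ℂ) :
    ∏ i, F i = F 0 * F 1 * F 2 * F 3 * F 4 * F 5 * F 6 * F 7 * F 8 * F 9 * F 10 * F 11 * F 12 *
      F 13 * F 14 * F 15 := by
  simp only [Fin.prod_univ_castSucc, Finset.univ_eq_empty, Finset.prod_empty, one_mul]
  rfl

theorem prod_rothPhase (S : Finset (ZMod p)) (P Q : ZMod p → ZMod p) (c : Fin 10 → ZMod p) :
    ∏ i, ∑ y ∈ S, (ZMod.stdAddChar (rothPhase p P Q c i y) : ℂ) =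
      diffKernel p S P Q (c 0) (c 1) (c 2) (c 6) *
      (starRingEnd ℂ) (diffKernel p S P Q (c 0) (c 1) (c 4) (c 6)) *
      (starRingEnd ℂ) (diffKernel p S P Q (c 0) (c 1) (c 2) (c 7)) *
      diffKernel p S P Q (c 0) (c 1) (c 4) (c 8) *
      (starRingEnd ℂ) (diffKernel p S P Q (c 0) (c 1) (c 5) (c 9)) *
      diffKernel p S P Q (c 0) (c 1) (c 3) (c 9) *
      diffKernel p S P Q (c 0) (c 1) (c 5) (c 7) *
      (starRingEnd ℂ) (diffKernel p S P Q (c 0) (c 1) (c 3) (c 8)) := by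
  simp only [diffKernel, map_mul, Complex.conj_conj]
  simp only [conj_expSum, prod_fin_sixteen, rothPhase, Matrix.cons_val]
  simp only [expSum]
  ring

theorem sum_norm_gram_sq (S : Finset (ZMod p)) (P Q : ZMod p → ZMod p) :
    ((∑ s, ∑ t, ∑ i, ∑ j, ‖gram (gram (diffKernel p S P Q s t)) i j‖ ^ 2 : ℝ) : ℂ) =
      (p : ℂ) ^ 10 * ((Fintype.piFinset fun _ : Fin 16 => S).filter
        fun y => ∀ j, rothForm p P Q j y = 0).card := by
  have h := sum_prod_stdAddChar p S (rothPhase p P Q) (rothForm p P Q) (sum_rothPhase p P Q)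
  rw [Fintype.card_fin] at h
  refine Eq.trans ?_ (h.trans (by congr!))
  simp only [Complex.ofReal_sum]
  iterate 4
    rw [sum_fin_succ_fun]
    refine Finset.sum_congr rfl fun _ _ => ?_
  conv_lhs =>
    rw [Complex.ofReal_pow, ← Complex.mul_conj']
    simp only [gram, map_sum, map_mul, Finset.sum_mul_sum]
  iterate 6
    rw [sum_fin_succ_fun]
    refine Finset.sum_congr rfl fun _ _ => ?_
  rw [Fintype.sum_unique, prod_rothPhase]
  simp only [Complex.conj_conj, Matrix.cons_val]
  ring

theorem corner_sq_pow_eight_le (S : Finset (ZMod p)) (P Q : ZMod p → ZMod p)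
    (f g : ZMod p → ZMod p → ℂ) :
    ((p : ℝ) ^ 4 * ∑ x, ∑ y, ‖∑ z ∈ S, f y (x + P z) * g x (y + Q z)‖ ^ 2) ^ 8 ≤
      ((p : ℝ) ^ 4 * ∑ x, ∑ y, ‖g x y‖ ^ 4) ^ 4 * ((p : ℝ) ^ 4 * ∑ y, ∑ x, ‖f y x‖ ^ 4) ^ 3 *
        (p * ∑ y, ∑ n, ‖charSum p (f y) n‖ ^ 4) *
        ((p : ℝ) ^ 10 * ((Fintype.piFinset fun _ : Fin 16 => S).filter
          fun y => ∀ j, rothForm p P Q j y = 0).card) := by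
  let a (h : ZMod p × ZMod p) : ℝ := √(∑ n, ‖fibreCorr p f n h.1 h.2‖ ^ 2)
  let b (h : ZMod p × ZMod p) : ℝ := √(∑ m, ‖fibreCorr p g m h.2 h.1‖ ^ 2)
  let r (h : ZMod p × ZMod p) : ℝ :=
    (∑ i, ∑ j, ‖gram (gram (diffKernel p S P Q h.1 h.2)) i j‖ ^ 2) ^ (8⁻¹ : ℝ)
  have ha : ∀ h, a h ^ 2 = ∑ n, ‖fibreCorr p f n h.1 h.2‖ ^ 2 := fun h =>
    Real.sq_sqrt (by positivity)
  have hb : ∀ h, b h ^ 2 = ∑ m, ‖fibreCorr p g m h.2 h.1‖ ^ 2 := fun h =>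
    Real.sq_sqrt (by positivity)
  have hr : ∀ h, r h ^ 8 =
      ∑ i, ∑ j, ‖gram (gram (diffKernel p S P Q h.1 h.2)) i j‖ ^ 2 := fun h => by
    rw [← Real.rpow_natCast, ← Real.rpow_mul (by positivity)]
    norm_num
  have hD : (p : ℝ) ^ 4 * ∑ x, ∑ y, ‖∑ z ∈ S, f y (x + P z) * g x (y + Q z)‖ ^ 2 ≤
      ∑ h, a h * b h * r h := by
    have hn := congrArg norm (sum_norm_corner_sq p S P Q f g)
    rw [norm_mul, norm_pow, Complex.norm_natCast, Complex.norm_real,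
      Real.norm_of_nonneg (by positivity)] at hn
    rw [hn, ← Fintype.sum_prod_type']
    refine (norm_sum_le _ _).trans (Finset.sum_le_sum fun h _ => ?_)
    refine (pow_le_pow_iff_left₀ (norm_nonneg _) (by positivity) (n := 8) (by norm_num)).mp ?_
    refine (norm_bilin_pow_eight_le _ _ _).trans_eq ?_
    rw [← ha, ← hb, ← hr]
    ring
  have hsa : ∑ h, a h ^ 2 ≤ (p : ℝ) ^ 4 * ∑ y, ∑ x, ‖f y x‖ ^ 4 := by
    simp_rw [ha, Fintype.sum_prod_type]
    exact sum_sum_norm_fibreCorr_sq_le p f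
  have hsb : ∑ h, b h ^ 2 ≤ (p : ℝ) ^ 4 * ∑ x, ∑ y, ‖g x y‖ ^ 4 := by
    simp_rw [hb, Fintype.sum_prod_type_right]
    exact sum_sum_norm_fibreCorr_sq_le p g
  have hsr : ∑ h, r h ^ 8 = (p : ℝ) ^ 10 * ((Fintype.piFinset fun _ : Fin 16 => S).filter
      fun y => ∀ j, rothForm p P Q j y = 0).card := by
    simp_rw [hr, Fintype.sum_prod_type]
    exact_mod_cast sum_norm_gram_sq p S P Q
  have hU : ∀ h, a h ≤ √(p * ∑ y, ∑ n, ‖charSum p (f y) n‖ ^ 4) := fun h =>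
    Real.sqrt_le_sqrt (sum_norm_fibreCorr_sq_le_pow_four p f h.1 h.2)
  calc _ ≤ (∑ h, a h * b h * r h) ^ 8 := by gcongr
    _ ≤ _ := sum_mul_mul_pow_eight_le (fun h => Real.sqrt_nonneg _) hU
    _ ≤ _ := by
        rw [Real.sq_sqrt (by positivity), hsr]
        gcongr

theorem forall_rothForm_eq_zero_iff (P Q : RatFunc ℚ) (y : Fin 16 → ZMod p) :
    (y ∈ (Fintype.piFinset fun _ : Fin 16 =>
        Finset.univ.filter fun z => ¬ IsPole p P z ∧ ¬ IsPole p Q z) ∧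
      ∀ j, rothForm p (evalRed p P) (evalRed p Q) j y = 0) ↔ IsRothPoint p P Q y := by
  simp only [Fintype.mem_piFinset, Finset.mem_filter, Finset.mem_univ, true_and, forall_and,
    IsRothPoint, rothForm]
  simp [Fin.forall_fin_succ, -neg_add_rev, -neg_sub]
  tauto

theorem rothCard_eq (P Q : RatFunc ℚ) :
    rothCard p P Q = ((Fintype.piFinset fun _ : Fin 16 =>
        Finset.univ.filter fun z => ¬ IsPole p P z ∧ ¬ IsPole p Q z).filter
      fun y => ∀ j, rothForm p (evalRed p P) (evalRed p Q) j y = 0).card := by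
  refine Nat.subtype_card _ fun y => ?_
  rw [Finset.mem_filter, forall_rothForm_eq_zero_iff]

theorem Lnorm_pow (n : ℕ) [NeZero n] (f : ZMod p × ZMod p → ℂ) :
    0 ≤ Lnorm p n f ∧ (p : ℝ) ^ 2 * Lnorm p n f ^ n = ∑ x, ‖f x‖ ^ n := by
  have hp : (0 : ℝ) < p := Nat.cast_pos.mpr (NeZero.pos p)
  refine ⟨by rw [Lnorm]; positivity, ?_⟩
  rw [Lnorm, Real.rpow_inv_natCast_pow (by positivity) (NeZero.ne n)]
  simp_rw [Real.rpow_natCast]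
  field_simp

theorem norm_cornerAvg_sq_le (P Q : RatFunc ℚ) (f0 f1 f2 : ZMod p × ZMod p → ℂ) :
    (p : ℝ) ^ 6 * ‖cornerAvg p P Q f0 f1 f2‖ ^ 2 ≤ (∑ x, ‖f0 x‖ ^ 2) *
      ∑ x, ∑ y, ‖∑ z with ¬ IsPole p P z ∧ ¬ IsPole p Q z,
        f1 (x + evalRed p P z, y) * f2 (x, y + evalRed p Q z)‖ ^ 2 := by
  have hp : (p : ℝ) ≠ 0 := Nat.cast_ne_zero.mpr (NeZero.ne p)
  have h := norm_sum_mul_sq_le f0 fun x => ∑ z with ¬ IsPole p P z ∧ ¬ IsPole p Q z,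
        f1 (x.1 + evalRed p P z, x.2) * f2 (x.1, x.2 + evalRed p Q z)
  rw [← Fintype.sum_prod_type']
  refine le_of_eq_of_le ?_ h
  rw [cornerAvg, norm_mul, norm_pow, norm_inv, Complex.norm_natCast, mul_pow, ← mul_assoc,
    ← pow_mul, ← mul_pow, mul_inv_cancel₀ hp, one_pow, one_mul, Fintype.sum_prod_type]
  simp_rw [Finset.mul_sum, Finset.sum_filter, mul_assoc]

/-- **Theorem 3.6.** Dual version of the Gowers norm control of the corner counting
operator via the point count of the Roth variety. -/
theorem gowers_control_dual (P Q : RatFunc ℚ) :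
    ∃ C : ℝ, 0 < C ∧ ∀ (p : ℕ) [Fact p.Prime],
      Admissible p P → Admissible p Q →
      ∀ f0 f1 f2 : ZMod p × ZMod p → ℂ,
        OneBounded f0 → OneBounded f1 → OneBounded f2 →
        ‖cornerAvg p P Q f0 f1 f2‖ ≤
          Lnorm p 2 f0 * Lnorm p 4 f1 ^ ((2:ℝ)⁻¹) * U2horiz p f1 ^ ((4:ℝ)⁻¹) *
            Lnorm p 4 f2 *
            ((rothCard p P Q : ℝ) / (p : ℝ) ^ 6) ^ ((16:ℝ)⁻¹) := by
  refine ⟨1, one_pos, fun p _ _ _ f0 f1 f2 _ h1 _ => ?_⟩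
  have hp : (0 : ℝ) < p := Nat.cast_pos.mpr (NeZero.pos p)
  obtain ⟨hL0, hL0'⟩ := Lnorm_pow p 2 f0
  obtain ⟨hL1, hL1'⟩ := Lnorm_pow p 4 f1
  obtain ⟨hL2, hL2'⟩ := Lnorm_pow p 4 f2
  obtain ⟨hU, hU'⟩ := U2horiz_pow_four p f1
  push_cast at hL0 hL0' hL1 hL1' hL2 hL2'
  have hL1_le : Lnorm p 4 f1 ≤ 1 := by
    refine (pow_le_one_iff_of_nonneg hL1 (n := 4) (by norm_num)).mp ?_
    refine le_of_mul_le_mul_left ?_ (pow_pos hp 2)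
    rw [hL1']
    refine (Finset.sum_le_sum fun x _ => pow_le_one₀ (norm_nonneg _) (h1 x)).trans_eq ?_
    simp [ZMod.card, sq]
  have hsq := norm_cornerAvg_sq_le p P Q f0 f1 f2
  have hD := corner_sq_pow_eight_le p
    (Finset.univ.filter fun z => ¬ IsPole p P z ∧ ¬ IsPole p Q z) (evalRed p P) (evalRed p Q)
    (fun y x => f1 (x, y)) (fun x y => f2 (x, y))
  rw [← rothCard_eq, ← hU', ← Fintype.sum_prod_type (fun x => ‖f2 x‖ ^ 4),
    ← Fintype.sum_prod_type_right (fun x => ‖f1 x‖ ^ 4), ← hL1', ← hL2'] at hD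
  rw [← hL0'] at hsq
  set D := ∑ x, ∑ y, ‖∑ z with ¬ IsPole p P z ∧ ¬ IsPole p Q z,
    f1 (x + evalRed p P z, y) * f2 (x, y + evalRed p Q z)‖ ^ 2
  set X := ‖cornerAvg p P Q f0 f1 f2‖
  set L0 := Lnorm p 2 f0
  set L1 := Lnorm p 4 f1
  set L2 := Lnorm p 4 f2
  set U := U2horiz p f1
  set Y : ℝ := (rothCard p P Q : ℝ)
  have hY : 0 ≤ Y := Nat.cast_nonneg _
  refine (pow_le_pow_iff_left₀ (norm_nonneg _) (by positivity) (n := 16) (by norm_num)).mp ?_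
  have hR : (L0 * L1 ^ ((2 : ℝ)⁻¹) * U ^ ((4 : ℝ)⁻¹) * L2 *
      (Y / (p : ℝ) ^ 6) ^ ((16 : ℝ)⁻¹)) ^ 16 =
      L0 ^ 16 * L1 ^ 8 * U ^ 4 * L2 ^ 16 * (Y / (p : ℝ) ^ 6) := by
    simp_rw [mul_pow]
    rw [← Real.rpow_mul_natCast hL1, ← Real.rpow_mul_natCast hU,
      ← Real.rpow_mul_natCast (by positivity)]
    norm_num
  rw [hR]
  have hX : (p : ℝ) ^ 80 * X ^ 16 ≤ (p : ℝ) ^ 74 * (L0 ^ 16 * L1 ^ 12 * U ^ 4 * L2 ^ 16 * Y) := by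
    calc (p : ℝ) ^ 80 * X ^ 16 = (p : ℝ) ^ 32 * ((p : ℝ) ^ 6 * X ^ 2) ^ 8 := by ring
      _ ≤ (p : ℝ) ^ 32 * ((p : ℝ) ^ 2 * L0 ^ 2 * D) ^ 8 := by gcongr
      _ = (p : ℝ) ^ 16 * L0 ^ 16 * ((p : ℝ) ^ 4 * D) ^ 8 := by ring
      _ ≤ _ := mul_le_mul_of_nonneg_left hD (by positivity)
      _ = _ := by ring
  have hL : L1 ^ 12 ≤ L1 ^ 8 := pow_le_pow_of_le_one hL1 hL1_le (by norm_num)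
  calc X ^ 16 = (p : ℝ) ^ 80 * X ^ 16 / (p : ℝ) ^ 80 := by field_simp
    _ ≤ (p : ℝ) ^ 74 * (L0 ^ 16 * L1 ^ 12 * U ^ 4 * L2 ^ 16 * Y) / (p : ℝ) ^ 80 := by gcongr
    _ = L0 ^ 16 * L1 ^ 12 * U ^ 4 * L2 ^ 16 * (Y / (p : ℝ) ^ 6) := by field_simp
    _ ≤ _ := by gcongr

end RatCorners
end
end
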